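/- arXiv:2402.08097 — 2 statements merged into one kernel-verified Lean document; each statement's English description precedes it below -/
import Mathlib

section
/- Suppose g satisfies the Hölderian error bound with r = 1 (weak sharpness). Run the AGM-BiO iteration with step sizes a_k = γ(k+1)/(4 L_f) where 0 < γ ≤ min{ 2 α L_f / (2 M L_g + α L_f), 1 } and M = max_{x ∈ X_g*} ‖∇f(x)‖. Then for every k ≥ 1, g(x_k) − g(x*) ≤ C_g (ln k + 1) / (k(k+1)) + α C_f / (γ M k(k+1)), where C_f = 4 L_f ‖x_0 − x*‖² and C_g = 8 L_g ‖x_0 − x*‖². -/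
open RealInnerProductSpace

section

variable {E : Type*} [NormedAddCommGroup E] [InnerProductSpace ℝ E]

/-- The three-point inequality for a point minimizing the distance to `z - a • v` over a convex
set. -/
theorem inner_le_of_forall_norm_le {K : Set E} (hK : Convex ℝ K) {z p v w : E} {a : ℝ}
    (hp : p ∈ K) (hmin : ∀ u ∈ K, ‖p - (z - a • v)‖ ≤ ‖u - (z - a • v)‖) (hw : w ∈ K) :
    a * ⟪v, p - w⟫ ≤ (‖z - w‖ ^ 2 - ‖p - w‖ ^ 2 - ‖p - z‖ ^ 2) / 2 := by
  have : Nonempty K := ⟨⟨p, hp⟩⟩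
  have hinf : ‖(z - a • v) - p‖ = ⨅ u : K, ‖(z - a • v) - u‖ :=
    le_antisymm
      (le_ciInf fun u => by simpa only [norm_sub_rev] using hmin u u.2)
      (ciInf_le ⟨0, Set.forall_mem_range.2 fun _ => norm_nonneg _⟩ (⟨p, hp⟩ : K))
  have hle := (norm_eq_iInf_iff_real_inner_le_zero hK hp).1 hinf w hw
  have hzw : ‖z - w‖ ^ 2 = ‖p - w‖ ^ 2 - 2 * ⟪p - w, p - z⟫ + ‖p - z‖ ^ 2 := by
    rw [← norm_sub_sq_real, sub_sub_sub_cancel_left]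
  have hexp : ⟪z - a • v - p, w - p⟫ = ⟪p - w, p - z⟫ + a * ⟪v, p - w⟫ := by
    rw [real_inner_comm, ← neg_sub p w, show z - a • v - p = -(p - z + a • v) by abel,
      inner_neg_neg, inner_add_right, real_inner_smul_right, real_inner_comm v]
  linarith

variable [CompleteSpace E]

theorem HasGradientAt.hasDerivAt_comp_line {h : E → ℝ} {p w d : E} {t : ℝ}
    (hh : HasGradientAt h p (w + t • d)) :
    HasDerivAt (fun s : ℝ => h (w + s • d)) ⟪p, d⟫ t := by
  have hline : HasDerivAt (fun s : ℝ => w + s • d) d t := by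
    simpa using ((hasDerivAt_id t).smul_const d).const_add w
  exact hh.hasFDerivAt.comp_hasDerivAt t hline

/-- The first-order lower bound for a differentiable convex function. -/
theorem ConvexOn.add_inner_gradient_le {h : E → ℝ} (hconv : ConvexOn ℝ Set.univ h) {p w : E}
    (hp : HasGradientAt h p w) (u : E) : h w + ⟪p, u - w⟫ ≤ h u := by
  have hline : ConvexOn ℝ Set.univ (fun s : ℝ => h (w + s • (u - w))) := by
    have := hconv.comp_affineMap (AffineMap.lineMap w u)
    simpa [Function.comp_def, AffineMap.lineMap_apply, add_comm] using this
  have hd : HasDerivAt (fun s : ℝ => h (w + s • (u - w))) ⟪p, u - w⟫ 0 :=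
    HasGradientAt.hasDerivAt_comp_line (by simpa using hp)
  have := hline.le_slope_of_hasDerivAt (Set.mem_univ _) (Set.mem_univ _) zero_lt_one hd
  simp only [slope_def_field, one_smul, zero_smul, add_zero, add_sub_cancel, sub_zero,
    div_one] at this
  linarith

/-- The quadratic upper bound for a function with Lipschitz gradient. -/
theorem le_add_inner_add_sq_of_lipschitz_gradient {h : E → ℝ} {h' : E → E} {L : ℝ}
    (hh : ∀ w, HasGradientAt h (h' w) w) (hLip : ∀ u v, ‖h' u - h' v‖ ≤ L * ‖u - v‖) (w u : E) :
    h u ≤ h w + ⟪h' w, u - w⟫ + L / 2 * ‖u - w‖ ^ 2 := by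
  set d := u - w with hd
  have hderiv (t : ℝ) : HasDerivAt (fun s : ℝ => h (w + s • d)) ⟪h' (w + t • d), d⟫ t :=
    (hh _).hasDerivAt_comp_line
  have hquad (t : ℝ) : HasDerivAt (fun s : ℝ => h w + s * ⟪h' w, d⟫ + L / 2 * ‖d‖ ^ 2 * s ^ 2)
      (⟪h' w, d⟫ + L * ‖d‖ ^ 2 * t) t := by
    refine ((((hasDerivAt_id t).mul_const ⟪h' w, d⟫).const_add (h w)).add
      ((hasDerivAt_pow 2 t).const_mul (L / 2 * ‖d‖ ^ 2))).congr_deriv ?_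
    norm_num
    ring
  have key := image_le_of_deriv_right_le_deriv_boundary (a := 0) (b := 1)
    (fun t _ => (hderiv t).continuousAt.continuousWithinAt)
    (fun t _ => (hderiv t).hasDerivWithinAt) (by simp)
    (fun t _ => (hquad t).continuousAt.continuousWithinAt)
    (fun t _ => (hquad t).hasDerivWithinAt)
    (fun t ht => by
      have h1 : ⟪h' (w + t • d) - h' w, d⟫ ≤ L * ‖t • d‖ * ‖d‖ :=
        (real_inner_le_norm _ _).trans
          (mul_le_mul_of_nonneg_right (by simpa using hLip (w + t • d) w) (norm_nonneg _))
      rw [inner_sub_left, norm_smul, Real.norm_of_nonneg ht.1] at h1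
      linarith)
    (Set.right_mem_Icc.2 zero_le_one)
  simpa [hd] using key

/-- One step of the accelerated scheme, for a single smooth convex function. -/
theorem ConvexOn.accelerated_step_le {h : E → ℝ} {h' : E → E} {L : ℝ}
    (hconv : ConvexOn ℝ Set.univ h) (hh : ∀ w, HasGradientAt h (h' w) w)
    (hLip : ∀ u v, ‖h' u - h' v‖ ≤ L * ‖u - v‖) {A a : ℝ} (hA : 0 ≤ A) (ha : 0 < a)
    {x y z x₁ z₁ : E} (hy : y = (A / (A + a)) • x + (a / (A + a)) • z)
    (hx₁ : x₁ = (A / (A + a)) • x + (a / (A + a)) • z₁) :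
    (A + a) * h x₁ ≤ A * h x + a * (h y + ⟪h' y, z₁ - y⟫) +
      L * (a ^ 2 / (2 * (A + a))) * ‖z₁ - z‖ ^ 2 := by
  have hpos : 0 < A + a := by linarith
  have hxy : x₁ - y = (a / (A + a)) • (z₁ - z) := by rw [hx₁, hy]; module
  have hcomb : x₁ - y = (A / (A + a)) • (x - y) + (a / (A + a)) • (z₁ - y) := by
    have hone : (A / (A + a) + a / (A + a)) • y = y := by
      rw [← add_div, div_self hpos.ne', one_smul]
    nth_rewrite 1 [← hone]
    rw [hx₁]; module
  have hinner : (A + a) * ⟪h' y, x₁ - y⟫ = A * ⟪h' y, x - y⟫ + a * ⟪h' y, z₁ - y⟫ := by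
    rw [hcomb, inner_add_right, real_inner_smul_right, real_inner_smul_right]
    field_simp
  have hnorm : (A + a) * (L / 2 * ‖x₁ - y‖ ^ 2) =
      L * (a ^ 2 / (2 * (A + a))) * ‖z₁ - z‖ ^ 2 := by
    rw [hxy, norm_smul, mul_pow, Real.norm_eq_abs, sq_abs]
    field_simp
  have hup := mul_le_mul_of_nonneg_left
    (le_add_inner_add_sq_of_lipschitz_gradient hh hLip y x₁) hpos.le
  have hlow := mul_le_mul_of_nonneg_left (hconv.add_inner_gradient_le (hh y) x) hA
  linarith

end

/-- A lower bound for the optimality gap over a set, in terms of the distance to that set. -/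
theorem ConvexOn.sub_le_mul_infDist {E : Type*} [NormedAddCommGroup E] [InnerProductSpace ℝ E]
    [ProperSpace E] {f : E → ℝ} {f' : E → E} {S : Set E}
    (hconv : ConvexOn ℝ Set.univ f) (hf' : ∀ w, HasGradientAt f (f' w) w)
    (hS : IsClosed S) (hne : S.Nonempty) {m M : ℝ}
    (hm : ∀ w ∈ S, m ≤ f w) (hM : ∀ w ∈ S, ‖f' w‖ ≤ M) (w : E) :
    m - f w ≤ M * Metric.infDist w S := by
  obtain ⟨p, hp, hdist⟩ := hS.exists_infDist_eq_dist hne w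
  rw [hdist, dist_comm, dist_eq_norm]
  have h1 := hconv.add_inner_gradient_le (hf' p) w
  have h2 := (real_inner_le_norm (f' p) (p - w)).trans
    (mul_le_mul_of_nonneg_right (hM p hp) (norm_nonneg _))
  rw [← neg_sub p w, inner_neg_right] at h1
  linarith [hm p hp]

theorem agm_bio_weak_sharp_infeasibility
    {n : ℕ} {f g : EuclideanSpace ℝ (Fin n) → ℝ}
    {f' g' : EuclideanSpace ℝ (Fin n) → EuclideanSpace ℝ (Fin n)}
    {Z : Set (EuclideanSpace ℝ (Fin n))}
    {L_f L_g : ℝ} (hLf : 0 < L_f) (hLg : 0 < L_g)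
    (hZconv : Convex ℝ Z) (hZcl : IsClosed Z)
    (hfconv : ConvexOn ℝ Set.univ f) (hgconv : ConvexOn ℝ Set.univ g)
    (hf' : ∀ w, HasGradientAt f (f' w) w)
    (hg' : ∀ w, HasGradientAt g (g' w) w)
    (hLipf : ∀ u v, ‖f' u - f' v‖ ≤ L_f * ‖u - v‖)
    (hLipg : ∀ u v, ‖g' u - g' v‖ ≤ L_g * ‖u - v‖)
    {xstar : EuclideanSpace ℝ (Fin n)}
    (hxZ : xstar ∈ Z)
    (hxlow : ∀ w ∈ Z, g xstar ≤ g w)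
    (hxopt : ∀ w ∈ Z, (∀ u ∈ Z, g w ≤ g u) → f xstar ≤ f w)
    {α : ℝ} (hα : 0 < α)
    (hHEB : ∀ w ∈ Z, α * Metric.infDist w {w ∈ Z | ∀ u ∈ Z, g w ≤ g u} ≤ g w - g xstar)
    {M : ℝ} (hM : IsGreatest ((fun w => ‖f' w‖) '' {w ∈ Z | ∀ u ∈ Z, g w ≤ g u}) M)
    {γ : ℝ} (hγ0 : 0 < γ)
    (hγ1 : γ ≤ min (2 * α * L_f / (2 * M * L_g + α * L_f)) 1)
    {x z y : ℕ → EuclideanSpace ℝ (Fin n)} {A a gs : ℕ → ℝ}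
    (hA0 : A 0 = 0) (hxz0 : x 0 = z 0)
    (ha : ∀ k : ℕ, a k = γ * ((k : ℝ) + 1) / (4 * L_f))
    (hArec : ∀ k, A (k + 1) = A k + a k)
    (hy : ∀ k, y k = (A k / (A k + a k)) • x k + (a k / (A k + a k)) • z k)
    (hgs : ∀ k : ℕ, 0 ≤ gs k - g xstar ∧
        gs k - g xstar ≤ 2 * L_g * ‖x 0 - xstar‖ ^ 2 / ((k : ℝ) + 1) ^ 2)
    (hzmem : ∀ k, z (k + 1) ∈ Z ∧ g (y k) + ⟪g' (y k), z (k + 1) - y k⟫ ≤ gs k)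
    (hzproj : ∀ k, ∀ w ∈ Z, g (y k) + ⟪g' (y k), w - y k⟫ ≤ gs k →
        ‖z (k + 1) - (z k - a k • f' (y k))‖ ≤ ‖w - (z k - a k • f' (y k))‖)
    (hxrec : ∀ k, x (k + 1) = (A k / (A k + a k)) • x k + (a k / (A k + a k)) • z (k + 1)) :
    ∀ k : ℕ, 1 ≤ k →
      g (x k) - g xstar ≤
        8 * L_g * ‖x 0 - xstar‖ ^ 2 * (Real.log (k : ℝ) + 1) / ((k : ℝ) * ((k : ℝ) + 1)) +
          α * (4 * L_f * ‖x 0 - xstar‖ ^ 2) / (γ * M * (k : ℝ) * ((k : ℝ) + 1)) := by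
  set S := {w ∈ Z | ∀ u ∈ Z, g w ≤ g u} with hS
  set D := ‖x 0 - xstar‖ ^ 2 with hD
  have hxS : xstar ∈ S := ⟨hxZ, hxlow⟩
  have hgcont : Continuous g := continuous_iff_continuousAt.2 fun w => (hg' w).continuousAt
  have hScl : IsClosed S := by
    have : S = Z ∩ ⋂ u ∈ Z, {w | g w ≤ g u} := by ext w; simp [hS]
    rw [this]
    exact hZcl.inter (isClosed_biInter fun u _ => isClosed_le hgcont continuous_const)
  have hMbd (w) (hw : w ∈ S) : ‖f' w‖ ≤ M := hM.2 ⟨w, hw, rfl⟩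
  have hM0 : 0 ≤ M := (norm_nonneg _).trans (hMbd _ hxS)
  have hD0 : 0 ≤ D := by positivity
  have hγle : γ ≤ 1 := hγ1.trans (min_le_right _ _)
  have hγM : γ * (2 * M * L_g + α * L_f) ≤ 2 * α * L_f :=
    (le_div_iff₀ (by positivity)).1 (hγ1.trans (min_le_left _ _))
  have hAk (k : ℕ) : A k = γ * (k * (k + 1)) / (8 * L_f) := by
    induction k with
    | zero => simp [hA0]
    | succ k ih => rw [hArec, ih, ha]; push_cast; field_simp; ring
  have hapos (k : ℕ) : 0 < a k := by rw [ha]; positivity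
  have hAnn (k : ℕ) : 0 ≤ A k := by rw [hAk]; positivity
  have hc (k : ℕ) : a k ^ 2 / (2 * (A k + a k)) ≤ γ / (4 * L_f) := by
    rw [← hArec, hAk, ha, div_le_div_iff₀ (by positivity) (by positivity)]
    have hk : (0 : ℝ) ≤ k := k.cast_nonneg
    push_cast
    field_simp
    nlinarith
  have hxmem (k : ℕ) : x (k + 1) ∈ Z := by
    induction k with
    | zero => simpa [hxrec, hA0, (hapos 0).ne'] using (hzmem 0).1
    | succ k ih =>
      rw [hxrec]
      have hpos : 0 < A (k + 1) + a (k + 1) := by linarith [hAnn (k + 1), hapos (k + 1)]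
      exact hZconv ih (hzmem _).1 (div_nonneg (hAnn _) hpos.le)
        (div_nonneg (hapos _).le hpos.le) (by rw [← add_div, div_self hpos.ne'])
  have hpot {β : ℝ} (hβ : 0 ≤ β) (hβγ : γ * (L_g + β * L_f) ≤ 2 * β * L_f) (k : ℕ) :
      β * (A k * (f (x k) - f xstar) + ‖z k - xstar‖ ^ 2 / 2) + A k * (g (x k) - g xstar) ≤
        β * D / 2 + γ * L_g * D / (2 * L_f) * (harmonic k : ℝ) := by
    induction k with
    | zero =>
      simp only [hA0, hD, hxz0, zero_mul, zero_add, add_zero, harmonic_zero, Rat.cast_zero, mul_zero]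
      linarith
    | succ k ih =>
      have hcut : Convex ℝ {w ∈ Z | g (y k) + ⟪g' (y k), w - y k⟫ ≤ gs k} := by
        have hlin : IsLinearMap ℝ fun w => ⟪g' (y k), w⟫ :=
          (innerₗ _ (g' (y k))).isLinear
        convert hZconv.inter (convex_halfSpace_le hlin (gs k - g (y k) + ⟪g' (y k), y k⟫)) using 1
        ext w
        simp only [Set.mem_ofPred_eq, Set.mem_inter_iff, inner_sub_right]
        refine and_congr_right fun _ => ⟨fun h => by linarith, fun h => by linarith⟩
      have hstar : g (y k) + ⟪g' (y k), xstar - y k⟫ ≤ gs k :=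
        (hgconv.add_inner_gradient_le (hg' _) _).trans (by linarith [(hgs k).1])
      have hproj := inner_le_of_forall_norm_le hcut (hzmem k) (fun u hu => hzproj k u hu.1 hu.2)
        (show xstar ∈ _ from ⟨hxZ, hstar⟩)
      have hF := hfconv.accelerated_step_le hf' hLipf (hAnn k) (hapos k) (hy k) (hxrec k)
      have hG := hgconv.accelerated_step_le hg' hLipg (hAnn k) (hapos k) (hy k) (hxrec k)
      have hlow := mul_le_mul_of_nonneg_left
        (hfconv.add_inner_gradient_le (hf' (y k)) xstar) (hapos k).le
      have hcutz := mul_le_mul_of_nonneg_left (hzmem k).2 (hapos k).le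
      have hsplit : ⟪f' (y k), z (k + 1) - y k⟫ =
          ⟪f' (y k), z (k + 1) - xstar⟫ + ⟪f' (y k), xstar - y k⟫ := by
        rw [← inner_add_right, sub_add_sub_cancel]
      rw [hsplit] at hF
      have herr : a k * (gs k - g xstar) ≤ γ * L_g * D / (2 * L_f) * ((k : ℝ) + 1)⁻¹ := by
        calc a k * (gs k - g xstar) ≤ a k * (2 * L_g * D / ((k : ℝ) + 1) ^ 2) :=
              mul_le_mul_of_nonneg_left (hgs k).2 (hapos k).le
          _ = _ := by rw [ha]; field_simp; ring
      rw [hArec, harmonic_succ]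
      push_cast
      have hcoef : a k ^ 2 / (2 * (A k + a k)) * (L_g + β * L_f) ≤ β / 2 := by
        calc _ ≤ γ / (4 * L_f) * (L_g + β * L_f) :=
              mul_le_mul_of_nonneg_right (hc k) (by positivity)
          _ ≤ β / 2 := by
              rw [div_mul_eq_mul_div, div_le_iff₀ (by positivity)]; linarith
      have hcoef' := mul_le_mul_of_nonneg_right hcoef (sq_nonneg ‖z (k + 1) - z k‖)
      generalize a k ^ 2 / (2 * (A k + a k)) = c at hF hG hcoef'
      have hF' : (A k + a k) * (f (x (k + 1)) - f xstar) + ‖z (k + 1) - xstar‖ ^ 2 / 2 ≤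
          A k * (f (x k) - f xstar) + ‖z k - xstar‖ ^ 2 / 2 +
            (L_f * c - 1 / 2) * ‖z (k + 1) - z k‖ ^ 2 := by
        linarith
      have := mul_le_mul_of_nonneg_left hF' hβ
      linarith
  intro k hk
  have hk0 : (0 : ℝ) < k := by exact_mod_cast hk
  have hApos : 0 < A k := by rw [hAk]; positivity
  have hxk : x k ∈ Z := by
    obtain ⟨j, rfl⟩ := Nat.exists_eq_add_of_le' hk
    exact hxmem j
  have hlog : (harmonic k : ℝ) ≤ Real.log k + 1 := by
    linarith [harmonic_le_one_add_log k]
  have hfgap : α * (f xstar - f (x k)) ≤ M * (g (x k) - g xstar) := by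
    have h1 := hfconv.sub_le_mul_infDist hf' hScl ⟨_, hxS⟩ (fun w hw => hxopt w hw.1 hw.2)
      hMbd (x k)
    calc α * (f xstar - f (x k)) ≤ α * (M * Metric.infDist (x k) S) :=
          mul_le_mul_of_nonneg_left h1 hα.le
      _ = M * (α * Metric.infDist (x k) S) := by ring
      _ ≤ _ := mul_le_mul_of_nonneg_left (hHEB _ hxk) hM0
  have herr := mul_le_mul_of_nonneg_left hlog
    (show 0 ≤ γ * L_g * D / (2 * L_f) by positivity)
  rcases hM0.eq_or_lt with hM0 | hMpos
  · -- here `1 / M = 0`; the first term of the bound alone suffices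
    subst hM0
    have hfge : 0 ≤ f (x k) - f xstar := by nlinarith
    have hpk := hpot (β := γ * L_g / L_f) (by positivity) (by field_simp; nlinarith) k
    have hlog1 : 0 ≤ Real.log k := Real.log_nonneg (by exact_mod_cast hk)
    have hnn : 0 ≤ γ * L_g / L_f * (A k * (f (x k) - f xstar) + ‖z k - xstar‖ ^ 2 / 2) := by
      positivity
    have hlog2 : 0 ≤ γ * L_g * D / (2 * L_f) * Real.log k := by positivity
    have hmain : A k * (g (x k) - g xstar) ≤ γ * L_g * D / L_f * (Real.log k + 1) := by
      have e1 : γ * L_g / L_f * D / 2 = γ * L_g * D / (2 * L_f) := by field_simp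
      have e2 : γ * L_g * D / L_f = 2 * (γ * L_g * D / (2 * L_f)) := by field_simp
      rw [e1] at hpk
      rw [e2]
      linarith
    rw [mul_zero, zero_mul, zero_mul, div_zero, add_zero]
    refine le_of_mul_le_mul_left (hmain.trans_eq ?_) hApos
    rw [hAk]
    field_simp
  · have hpk := hpot (β := α / (2 * M)) (by positivity) (by field_simp; linarith) k
    have hgap : -(A k * (g (x k) - g xstar)) / 2 ≤
        α / (2 * M) * (A k * (f (x k) - f xstar)) := by
      have := mul_le_mul_of_nonneg_left hfgap (show 0 ≤ A k / (2 * M) by positivity)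
      have e : A k / (2 * M) * (M * (g (x k) - g xstar)) = A k * (g (x k) - g xstar) / 2 := by
        field_simp
      rw [e] at this
      linear_combination this
    have hnn : 0 ≤ α / (2 * M) * (‖z k - xstar‖ ^ 2 / 2) := by positivity
    have hmain : A k * (g (x k) - g xstar) ≤
        α / (2 * M) * D + γ * L_g * D / L_f * (Real.log k + 1) := by
      have e2 : γ * L_g * D / L_f = 2 * (γ * L_g * D / (2 * L_f)) := by field_simp
      rw [e2]
      linarith
    refine le_of_mul_le_mul_left (hmain.trans_eq ?_) hApos
    rw [hAk]
    field_simp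
    ring
end

section
/- Under the P-AGM-BiO iteration for the composite bilevel problem with arbitrary positive step sizes a_k > 0, for every k ≥ 0 it holds that A_{k+1}(f(x_{k+1}) − f(x*)) + ½‖z_{k+1} − x*‖² − ( A_k(f(x_k) − f(x*)) + ½‖z_k − x*‖² ) ≤ ( L_f a_k² / (2 A_{k+1}) − ½ ) ‖z_{k+1} − z_k‖². -/
open RealInnerProductSpace

section GradientInequalities

variable {E : Type*} [NormedAddCommGroup E] [InnerProductSpace ℝ E]

theorem HasGradientAt.hasDerivAt_comp_lineMap [CompleteSpace E] {f : E → ℝ} {f' : E → E}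
    (hf : ∀ w, HasGradientAt f (f' w) w) (u v : E) (t : ℝ) :
    HasDerivAt (fun s : ℝ => f (AffineMap.lineMap u v s))
      ⟪f' (AffineMap.lineMap u v t), v - u⟫ t := by
  have h := (hf (AffineMap.lineMap u v t)).hasFDerivAt.comp_hasDerivAt t
    (AffineMap.hasDerivAt_lineMap (a := u) (b := v) (x := t))
  rw [InnerProductSpace.toDual_apply_apply] at h
  exact h

/-- A differentiable convex function lies above its linearizations. -/
theorem ConvexOn.add_inner_gradient_le_s14 [CompleteSpace E] {f : E → ℝ} {f' : E → E}
    (hc : ConvexOn ℝ Set.univ f) (hf : ∀ w, HasGradientAt f (f' w) w) (u v : E) :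
    f u + ⟪f' u, v - u⟫ ≤ f v := by
  have hφ : ConvexOn ℝ Set.univ (fun s : ℝ => f (AffineMap.lineMap u v s)) :=
    hc.comp_affineMap (AffineMap.lineMap u v)
  have h := hφ.le_slope_of_hasDerivAt (Set.mem_univ 0) (Set.mem_univ 1) one_pos
    (HasGradientAt.hasDerivAt_comp_lineMap hf u v 0)
  simp [slope_def_field] at h
  linarith

/-- The descent lemma for functions with Lipschitz gradient. -/
theorem HasGradientAt.le_add_inner_add_sq [CompleteSpace E] {f : E → ℝ} {f' : E → E} {L : ℝ}
    (hf : ∀ w, HasGradientAt f (f' w) w) (hL : ∀ u v, ‖f' u - f' v‖ ≤ L * ‖u - v‖) (u v : E) :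
    f v ≤ f u + ⟪f' u, v - u⟫ + L / 2 * ‖v - u‖ ^ 2 := by
  let ψ : ℝ → ℝ := fun s =>
    f (AffineMap.lineMap u v s) - s * ⟪f' u, v - u⟫ - s ^ 2 * (L / 2 * ‖v - u‖ ^ 2)
  have hψ (t : ℝ) : HasDerivAt ψ (⟪f' (AffineMap.lineMap u v t), v - u⟫ - ⟪f' u, v - u⟫
      - 2 * t * (L / 2 * ‖v - u‖ ^ 2)) t := by
    have h := ((HasGradientAt.hasDerivAt_comp_lineMap hf u v t).sub
      ((hasDerivAt_id t).mul_const ⟪f' u, v - u⟫)).sub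
      ((hasDerivAt_pow 2 t).mul_const (L / 2 * ‖v - u‖ ^ 2))
    refine HasDerivAt.congr_deriv (f := ψ) h ?_
    simp
  have hanti : AntitoneOn ψ (Set.Icc 0 1) := by
    refine antitoneOn_of_deriv_nonpos (convex_Icc 0 1)
      (fun t _ => (hψ t).continuousAt.continuousWithinAt)
      (fun t _ => (hψ t).differentiableAt.differentiableWithinAt) fun t ht => ?_
    rw [interior_Icc] at ht
    rw [(hψ t).deriv, ← inner_sub_left]
    have hlip := hL (AffineMap.lineMap u v t) u
    have hnorm : ‖AffineMap.lineMap u v t - u‖ = t * ‖v - u‖ := by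
      rw [AffineMap.lineMap_apply_module', add_sub_cancel_right, norm_smul,
        Real.norm_of_nonneg ht.1.le]
    rw [hnorm] at hlip
    have hcs := real_inner_le_norm (f' (AffineMap.lineMap u v t) - f' u) (v - u)
    have hmul := mul_le_mul_of_nonneg_right hlip (norm_nonneg (v - u))
    linarith
  have h := hanti (Set.left_mem_Icc.2 zero_le_one) (Set.right_mem_Icc.2 zero_le_one) zero_le_one
  simp [ψ] at h
  linarith

/-- The three-point inequality for a minimizer `p` of `c * ‖u - w‖ ^ 2 + h u` over a convex set. -/
theorem ConvexOn.prox_three_point {S : Set E} {h : E → ℝ} (hh : ConvexOn ℝ S h) {c : ℝ}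
    {p w : E} (hp : p ∈ S)
    (hmin : ∀ u ∈ S, c * ‖p - w‖ ^ 2 + h p ≤ c * ‖u - w‖ ^ 2 + h u) {u : E} (hu : u ∈ S) :
    c * ‖p - w‖ ^ 2 + h p + c * ‖u - p‖ ^ 2 ≤ c * ‖u - w‖ ^ 2 + h u := by
  have key (t : ℝ) (ht : t ∈ Set.Ioo (0 : ℝ) 1) :
      c * ‖p - w‖ ^ 2 + h p + (1 - t) * (c * ‖u - p‖ ^ 2) ≤ c * ‖u - w‖ ^ 2 + h u := by
    have ht' : 0 ≤ 1 - t := sub_nonneg.2 ht.2.le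
    have hmem := hh.1 hp hu ht' ht.1.le (sub_add_cancel 1 t)
    have hconv := hh.2 hp hu ht' ht.1.le (sub_add_cancel 1 t)
    have hm := hmin _ hmem
    have hsq : ‖(1 - t) • p + t • u - w‖ ^ 2 =
        (1 - t) * ‖p - w‖ ^ 2 + t * ‖u - w‖ ^ 2 - t * (1 - t) * ‖u - p‖ ^ 2 := by
      have e₁ : (1 - t) • p + t • u - w = (1 - t) • (p - w) + t • (u - w) := by module
      have e₂ : u - p = (u - w) - (p - w) := by abel
      rw [e₁, e₂, norm_add_sq_real, norm_sub_sq_real (u - w) (p - w), norm_smul, norm_smul, mul_pow, mul_pow,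
        real_inner_smul_left, real_inner_smul_right, real_inner_comm (p - w) (u - w)]
      simp only [Real.norm_eq_abs, sq_abs]
      ring
    rw [hsq] at hm
    simp only [smul_eq_mul] at hconv
    refine le_of_mul_le_mul_left ?_ ht.1
    linarith
  have hlim : Filter.Tendsto
      (fun t : ℝ => c * ‖p - w‖ ^ 2 + h p + (1 - t) * (c * ‖u - p‖ ^ 2)) (nhdsWithin 0 (Set.Ioi 0))
      (nhds (c * ‖p - w‖ ^ 2 + h p + (1 - 0) * (c * ‖u - p‖ ^ 2))) :=
    (Continuous.tendsto (by fun_prop) 0).mono_left nhdsWithin_le_nhds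
  have := le_of_tendsto hlim (Filter.mem_of_superset (Ioo_mem_nhdsGT one_pos) key)
  simpa using this

end GradientInequalities



theorem pagm_bio_potential_f
    {n : ℕ} {f₁ f₂ g₁ g₂ : EuclideanSpace ℝ (Fin n) → ℝ}
    {f₁' g₁' : EuclideanSpace ℝ (Fin n) → EuclideanSpace ℝ (Fin n)}
    {L_f L_g : ℝ} (hLf : 0 < L_f) (hLg : 0 < L_g)
    (hf₁conv : ConvexOn ℝ Set.univ f₁) (hf₂conv : ConvexOn ℝ Set.univ f₂)
    (hg₁conv : ConvexOn ℝ Set.univ g₁) (hg₂conv : ConvexOn ℝ Set.univ g₂)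
    (hf₁' : ∀ w, HasGradientAt f₁ (f₁' w) w)
    (hg₁' : ∀ w, HasGradientAt g₁ (g₁' w) w)
    (hLipf : ∀ u v, ‖f₁' u - f₁' v‖ ≤ L_f * ‖u - v‖)
    (hLipg : ∀ u v, ‖g₁' u - g₁' v‖ ≤ L_g * ‖u - v‖)
    {xstar : EuclideanSpace ℝ (Fin n)}
    (hxlow : ∀ w, g₁ xstar + g₂ xstar ≤ g₁ w + g₂ w)
    (hxopt : ∀ w, (∀ u, g₁ w + g₂ w ≤ g₁ u + g₂ u) → f₁ xstar + f₂ xstar ≤ f₁ w + f₂ w)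
    {x z y : ℕ → EuclideanSpace ℝ (Fin n)} {A a gs : ℕ → ℝ}
    (hA0 : A 0 = 0) (hxz0 : x 0 = z 0)
    (ha : ∀ k, 0 < a k)
    (hArec : ∀ k, A (k + 1) = A k + a k)
    (hy : ∀ k, y k = (A k / (A k + a k)) • x k + (a k / (A k + a k)) • z k)
    (hgs : ∀ k, g₁ xstar + g₂ xstar ≤ gs k)
    (hzmem : ∀ k, g₁ (y k) + ⟪g₁' (y k), z (k + 1) - y k⟫ + g₂ (z (k + 1)) ≤ gs k)
    (hzprox : ∀ k, ∀ u, g₁ (y k) + ⟪g₁' (y k), u - y k⟫ + g₂ u ≤ gs k →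
        1 / (2 * a k) * ‖z (k + 1) - (z k - a k • f₁' (y k))‖ ^ 2 + f₂ (z (k + 1)) ≤
          1 / (2 * a k) * ‖u - (z k - a k • f₁' (y k))‖ ^ 2 + f₂ u)
    (hxrec : ∀ k, x (k + 1) = (A k / (A k + a k)) • x k + (a k / (A k + a k)) • z (k + 1)) :
    ∀ k : ℕ,
      A (k + 1) * (f₁ (x (k + 1)) + f₂ (x (k + 1)) - (f₁ xstar + f₂ xstar)) +
          1 / 2 * ‖z (k + 1) - xstar‖ ^ 2 -
          (A k * (f₁ (x k) + f₂ (x k) - (f₁ xstar + f₂ xstar)) + 1 / 2 * ‖z k - xstar‖ ^ 2) ≤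
        (L_f * a k ^ 2 / (2 * A (k + 1)) - 1 / 2) * ‖z (k + 1) - z k‖ ^ 2 := by
  intro k
  have hak := ha k
  have hA (j : ℕ) : 0 ≤ A j := by
    induction j with
    | zero => exact hA0.ge
    | succ j ih => rw [hArec]; exact add_nonneg ih (ha j).le
  have hAk := hA k
  have hpos : 0 < A k + a k := by linarith
  have hne := hpos.ne'
  have hX : ConvexOn ℝ {u | g₁ (y k) + ⟪g₁' (y k), u - y k⟫ + g₂ u ≤ gs k} f₂ := by
    refine hf₂conv.subset (Set.subset_univ _) fun u hu v hv s t hs ht hst => ?_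
    have hg := hg₂conv.2 (Set.mem_univ u) (Set.mem_univ v) hs ht hst
    have hin : ⟪g₁' (y k), s • u + t • v - y k⟫ =
        s * ⟪g₁' (y k), u - y k⟫ + t * ⟪g₁' (y k), v - y k⟫ := by
      rw [← real_inner_smul_right, ← real_inner_smul_right, ← inner_add_right]
      congr 1
      rw [← eq_sub_iff_add_eq] at hst
      subst hst
      module
    simp only [Set.mem_ofPred_eq, smul_eq_mul] at hu hv hg ⊢
    rw [hin]
    have h₁ := mul_le_mul_of_nonneg_left hu hs
    have h₂ := mul_le_mul_of_nonneg_left hv ht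
    have h₃ : s * g₁ (y k) + t * g₁ (y k) = g₁ (y k) := by rw [← add_mul, hst, one_mul]
    have h₄ : s * gs k + t * gs k = gs k := by rw [← add_mul, hst, one_mul]
    linarith
  have hstar : g₁ (y k) + ⟪g₁' (y k), xstar - y k⟫ + g₂ xstar ≤ gs k := by
    linarith [hg₁conv.add_inner_gradient_le_s14 hg₁' (y k) xstar, hgs k]
  have hprox : 1 / 2 * ‖z (k + 1) - (z k - a k • f₁' (y k))‖ ^ 2 + a k * f₂ (z (k + 1)) +
      1 / 2 * ‖xstar - z (k + 1)‖ ^ 2 ≤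
      1 / 2 * ‖xstar - (z k - a k • f₁' (y k))‖ ^ 2 + a k * f₂ xstar := by
    have h := mul_le_mul_of_nonneg_left
      (hX.prox_three_point (hzmem k) (hzprox k) hstar) hak.le
    have hc : a k * (1 / (2 * a k)) = 1 / 2 := by field_simp
    simpa only [mul_add, ← mul_assoc, hc] using h
  have hexpand (u : EuclideanSpace ℝ (Fin n)) : ‖u - (z k - a k • f₁' (y k))‖ ^ 2 =
      ‖u - z k‖ ^ 2 + 2 * (a k * ⟪f₁' (y k), u - z k⟫) + ‖a k • f₁' (y k)‖ ^ 2 := by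
    rw [← sub_add, norm_add_sq_real, real_inner_smul_right, real_inner_comm]
  rw [hexpand, hexpand, norm_sub_rev xstar (z (k + 1)), norm_sub_rev xstar (z k)] at hprox
  have hdiff : x (k + 1) - y k = (a k / (A k + a k)) • (z (k + 1) - z k) := by
    rw [hxrec, hy]; module
  have hdescent := mul_le_mul_of_nonneg_left
    (HasGradientAt.le_add_inner_add_sq hf₁' hLipf (y k) (x (k + 1))) hpos.le
  rw [hdiff, real_inner_smul_right, norm_smul, mul_pow, Real.norm_eq_abs, sq_abs] at hdescent
  have hdescent' : (A k + a k) * f₁ (x (k + 1)) ≤ (A k + a k) * f₁ (y k) +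
      a k * ⟪f₁' (y k), z (k + 1) - z k⟫ +
      L_f * a k ^ 2 / (2 * (A k + a k)) * ‖z (k + 1) - z k‖ ^ 2 := by
    refine hdescent.trans_eq ?_
    field_simp
  have hf₂ : (A k + a k) * f₂ (x (k + 1)) ≤ A k * f₂ (x k) + a k * f₂ (z (k + 1)) := by
    have h := mul_le_mul_of_nonneg_left (hf₂conv.2 (Set.mem_univ (x k)) (Set.mem_univ (z (k + 1)))
      (div_nonneg hAk hpos.le) (div_nonneg hak.le hpos.le) (by field_simp)) hpos.le
    rw [← hxrec] at h
    refine h.trans_eq ?_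
    simp only [smul_eq_mul]
    field_simp
  have hgx := mul_le_mul_of_nonneg_left (hf₁conv.add_inner_gradient_le_s14 hf₁' (y k) (x k)) hAk
  have hgs' := mul_le_mul_of_nonneg_left (hf₁conv.add_inner_gradient_le_s14 hf₁' (y k) xstar) hak.le
  have hbal : A k * ⟪f₁' (y k), x k - y k⟫ + a k * ⟪f₁' (y k), z k - y k⟫ = 0 := by
    rw [← real_inner_smul_right, ← real_inner_smul_right, ← inner_add_right]
    have : A k • (x k - y k) + a k • (z k - y k) = 0 := by
      have hyk : (A k + a k) • y k = A k • x k + a k • z k := by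
        rw [hy, smul_add, smul_smul, smul_smul, mul_div_cancel₀ _ hne, mul_div_cancel₀ _ hne]
      rw [← sub_eq_zero.2 hyk.symm]
      module
    rw [this, inner_zero_right]
  rw [hArec]
  simp only [inner_sub_right] at *
  linarith
end
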